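/- arXiv:2210.17462 — 7 statements merged into one kernel-verified Lean document; each statement's English description precedes it below -/
import Mathlib

section
/- Let r, W, V, N be a solution of the BFM system on an open interval I. Then the function κ := (1/(2N))(1 + N² + 2V²/r² − (1−W²)²/r²) is differentiable on I and satisfies the Riccati-type equation κ̇(ρ) = 1 + 2V(ρ)²/r(ρ)² − κ(ρ)² for all ρ ∈ I. -/
/-- The function `κ = (1/(2N))(1 + N² + 2V²/r² − (1−W²)²/r²)` built from the
unknowns of the BFM system. -/
noncomputable def bfmKappa (r W V N : ℝ → ℝ) (ρ : ℝ) : ℝ :=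
  1 / (2 * N ρ) * (1 + N ρ ^ 2 + 2 * V ρ ^ 2 / r ρ ^ 2 - (1 - W ρ ^ 2) ^ 2 / r ρ ^ 2)

/-- `r, W, V, N` is a solution of the BFM system on the set `I`:
`ṙ = rN`, `Ẇ = V`, `V̇ = (2N−κ)V − W(1−W²)`, `Ṅ = (κ−N)N − 2V²/r²`,
with `r > 0` and `N ≠ 0` on `I`. -/
def IsBFMSolution (I : Set ℝ) (r W V N : ℝ → ℝ) : Prop :=
  (∀ ρ ∈ I, 0 < r ρ) ∧ (∀ ρ ∈ I, N ρ ≠ 0) ∧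
  (∀ ρ ∈ I, HasDerivAt r (r ρ * N ρ) ρ) ∧
  (∀ ρ ∈ I, HasDerivAt W (V ρ) ρ) ∧
  (∀ ρ ∈ I, HasDerivAt V ((2 * N ρ - bfmKappa r W V N ρ) * V ρ - W ρ * (1 - W ρ ^ 2)) ρ) ∧
  (∀ ρ ∈ I, HasDerivAt N ((bfmKappa r W V N ρ - N ρ) * N ρ - 2 * V ρ ^ 2 / r ρ ^ 2) ρ)

/-- For a solution of the BFM system on an open interval `(a,b)`,
the function `κ` is differentiable and satisfies the Riccati-type equation
`κ̇ = 1 + 2V²/r² − κ²`. -/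
theorem bfm_kappa_riccati (a b : ℝ) (r W V N : ℝ → ℝ)
    (h : IsBFMSolution (Set.Ioo a b) r W V N) :
    ∀ ρ ∈ Set.Ioo a b,
      HasDerivAt (bfmKappa r W V N)
        (1 + 2 * V ρ ^ 2 / r ρ ^ 2 - bfmKappa r W V N ρ ^ 2) ρ := by
  obtain ⟨hr, hN, hr', hW', hV', hN'⟩ := h
  intro ρ hρ
  have hr0 : r ρ ≠ 0 := (hr ρ hρ).ne'
  have hN0 : N ρ ≠ 0 := hN ρ hρ
  have dr := hr' ρ hρ
  have dW := hW' ρ hρ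
  have dV := hV' ρ hρ
  have dN := hN' ρ hρ
  have hκ : (1 - W ρ ^ 2) ^ 2
      = r ρ ^ 2 * (1 + N ρ ^ 2 - 2 * N ρ * bfmKappa r W V N ρ) + 2 * V ρ ^ 2 := by
    unfold bfmKappa
    field_simp
    ring
  have hκ_num : 1 + N ρ ^ 2 + 2 * V ρ ^ 2 / r ρ ^ 2 - (1 - W ρ ^ 2) ^ 2 / r ρ ^ 2
      = 2 * N ρ * bfmKappa r W V N ρ := by
    unfold bfmKappa
    field_simp
  have hr2 : r ρ ^ 2 ≠ 0 := pow_ne_zero 2 hr0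
  have hd := ((hasDerivAt_const ρ (1 : ℝ)).fun_div (dN.const_mul 2)
      (mul_ne_zero two_ne_zero hN0)).fun_mul
    ((((dN.fun_pow 2).const_add 1).fun_add (((dV.fun_pow 2).const_mul 2).fun_div
      (dr.fun_pow 2) hr2)).fun_sub ((((dW.fun_pow 2).const_sub 1).fun_pow 2).fun_div
      (dr.fun_pow 2) hr2))
  refine HasDerivAt.congr_deriv (f := bfmKappa r W V N) hd ?_
  rw [hκ_num, hκ]
  generalize bfmKappa r W V N ρ = κ
  field_simp
  push_cast
  ring
end

section
/- Let r, W, V, N be a solution of the BFM system on an open interval I, let κ := (1/(2N))(1 + N² + 2V²/r² − (1−W²)²/r²), and set γ := κ + N. Then γ is differentiable on I and satisfies γ̇(ρ) = 1 − γ(ρ)² + 3N(ρ)(γ(ρ) − N(ρ)) for all ρ ∈ I; in particular, at any point ρ ∈ I with γ(ρ) = 2 one has γ̇(ρ) = −3(1 − N(ρ))². -/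
/-- For a solution of the BFM system on an open interval `(a,b)`,
the function `γ = κ + N` is differentiable and satisfies
`γ̇ = 1 − γ² + 3N(γ − N)`; in particular, whenever `γ = 2` one has
`γ̇ = −3(1 − N)²`. -/
theorem bfm_gamma_equation (a b : ℝ) (r W V N : ℝ → ℝ)
    (h : IsBFMSolution (Set.Ioo a b) r W V N) :
    ∀ ρ ∈ Set.Ioo a b,
      HasDerivAt (fun ρ' => bfmKappa r W V N ρ' + N ρ')
        (1 - (bfmKappa r W V N ρ + N ρ) ^ 2
          + 3 * N ρ * (bfmKappa r W V N ρ + N ρ - N ρ)) ρ ∧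
      (bfmKappa r W V N ρ + N ρ = 2 →
        1 - (bfmKappa r W V N ρ + N ρ) ^ 2
          + 3 * N ρ * (bfmKappa r W V N ρ + N ρ - N ρ) = -3 * (1 - N ρ) ^ 2) := by
  intro ρ hρ
  obtain ⟨hr, hN, hdr, hdW, hdV, hdN⟩ := h
  have hr0 : r ρ ≠ 0 := (hr ρ hρ).ne'
  have hN0 := hN ρ hρ
  specialize hdr ρ hρ
  specialize hdW ρ hρ
  specialize hdV ρ hρ
  specialize hdN ρ hρ
  have hκ : 2 * N ρ * bfmKappa r W V N ρ * r ρ ^ 2 =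
      (1 + N ρ ^ 2) * r ρ ^ 2 + 2 * V ρ ^ 2 - (1 - W ρ ^ 2) ^ 2 := by
    unfold bfmKappa
    field_simp
  have hdκ : HasDerivAt (bfmKappa r W V N) _ ρ :=
    ((hasDerivAt_const ρ (1 : ℝ)).fun_div (hdN.const_mul 2) (mul_ne_zero two_ne_zero hN0)).fun_mul
      ((((hdN.fun_pow 2).const_add 1).fun_add
        (((hdV.fun_pow 2).const_mul 2).fun_div (hdr.fun_pow 2) (pow_ne_zero 2 hr0))).fun_sub
        ((((hdW.fun_pow 2).const_sub 1).fun_pow 2).fun_div (hdr.fun_pow 2) (pow_ne_zero 2 hr0)))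
  refine ⟨(hdκ.fun_add hdN).congr_deriv ?_, fun hγ => ?_⟩
  · generalize bfmKappa r W V N ρ = k at hκ ⊢
    have hw : (1 - W ρ ^ 2) ^ 2 =
        (1 + N ρ ^ 2) * r ρ ^ 2 + 2 * V ρ ^ 2 - 2 * N ρ * k * r ρ ^ 2 := by
      linear_combination hκ
    rw [hw]
    field_simp
    ring
  · have hκγ : bfmKappa r W V N ρ = 2 - N ρ := by linarith
    rw [hκγ]
    ring
end

section
/- Let r, W, V, N be a solution of the BFM system on an open interval I, and let κ := (1/(2N))(1 + N² + 2V²/r² − (1−W²)²/r²). If κ(ρ*) ≥ 1 for some ρ* ∈ I, then κ(ρ) ≥ 1 for all ρ ∈ I with ρ ≥ ρ*. (The function κ cannot cross the line κ = 1 from above, since κ̇ = 1 + 2V²/r² − κ² ≥ 1 − κ².) -/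
/-- Along a solution of the BFM system, `κ̇ = 1 + 2V²/r² − κ²`. -/
theorem IsBFMSolution.hasDerivAt_bfmKappa {I : Set ℝ} {r W V N : ℝ → ℝ}
    (h : IsBFMSolution I r W V N) {ρ : ℝ} (hρ : ρ ∈ I) :
    HasDerivAt (bfmKappa r W V N)
      (1 + 2 * V ρ ^ 2 / r ρ ^ 2 - bfmKappa r W V N ρ ^ 2) ρ := by
  obtain ⟨hr, hN, dr, dW, dV, dN⟩ := h
  have hr0 : r ρ ≠ 0 := (hr ρ hρ).ne'
  have hN0 := hN ρ hρ
  have dr := dr ρ hρ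
  have dW := dW ρ hρ
  have dV := dV ρ hρ
  have dN := dN ρ hρ
  have hr2 : r ρ ^ 2 ≠ 0 := pow_ne_zero 2 hr0
  have hκ : bfmKappa r W V N ρ =
      1 / (2 * N ρ) * (1 + N ρ ^ 2 + 2 * V ρ ^ 2 / r ρ ^ 2 - (1 - W ρ ^ 2) ^ 2 / r ρ ^ 2) := rfl
  have key := ((hasDerivAt_const ρ (1 : ℝ)).fun_div (dN.const_mul 2)
    (mul_ne_zero two_ne_zero hN0)).fun_mul
    ((((dN.fun_pow 2).const_add 1).fun_add
      (((dV.fun_pow 2).const_mul 2).fun_div (dr.fun_pow 2) hr2)).fun_sub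
      ((((dW.fun_pow 2).const_sub 1).fun_pow 2).fun_div (dr.fun_pow 2) hr2))
  refine key.congr_deriv ?_
  rw [hκ]
  field_simp
  ring

/-- If `f' ≥ -p f` on `(a, b)` with `p` continuous, then `f` stays nonnegative once it is. -/
theorem nonneg_of_neg_mul_le_deriv {a b : ℝ} {f f' p : ℝ → ℝ}
    (hf : ∀ x ∈ Set.Ioo a b, HasDerivAt f (f' x) x)
    (hp : ContinuousOn p (Set.Ioo a b))
    (hle : ∀ x ∈ Set.Ioo a b, -(p x * f x) ≤ f' x)
    {s t : ℝ} (hs : s ∈ Set.Ioo a b) (ht : t ∈ Set.Ioo a b) (hst : s ≤ t)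
    (hfs : 0 ≤ f s) : 0 ≤ f t := by
  have hP : ∀ x ∈ Set.Ioo a b, HasDerivAt (fun y => ∫ z in s..y, p z) (p x) x := fun x hx =>
    intervalIntegral.integral_hasDerivAt_right
      (hp.mono (Set.ordConnected_Ioo.uIcc_subset hs hx)).intervalIntegrable
      (hp.stronglyMeasurableAtFilter isOpen_Ioo x hx)
      (hp.continuousAt (isOpen_Ioo.mem_nhds hx))
  have hg : ∀ x ∈ Set.Ioo a b, HasDerivAt (fun y => f y * Real.exp (∫ z in s..y, p z))
      (f' x * Real.exp (∫ z in s..x, p z) + f x * (Real.exp (∫ z in s..x, p z) * p x)) x :=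
    fun x hx => (hf x hx).fun_mul (hP x hx).exp
  have hmono : MonotoneOn (fun y => f y * Real.exp (∫ z in s..y, p z)) (Set.Ioo a b) := by
    refine monotoneOn_of_hasDerivWithinAt_nonneg (convex_Ioo a b)
      (fun x hx => (hg x hx).continuousAt.continuousWithinAt)
      (fun x hx => (hg x (interior_subset hx)).hasDerivWithinAt) fun x hx => ?_
    have hfactor : f' x * Real.exp (∫ z in s..x, p z)
        + f x * (Real.exp (∫ z in s..x, p z) * p x)
        = (f' x + p x * f x) * Real.exp (∫ z in s..x, p z) := by ring
    rw [hfactor]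
    exact mul_nonneg (by linarith [hle x (interior_subset hx)]) (Real.exp_pos _).le
  have hle_st := hmono hs ht hst
  simp only [intervalIntegral.integral_same, Real.exp_zero, mul_one] at hle_st
  exact nonneg_of_mul_nonneg_left (hfs.trans hle_st) (Real.exp_pos _)


/-- For a solution of the BFM system on an open interval `(a,b)`,
if `κ(ρ*) ≥ 1` at some `ρ* ∈ (a,b)`, then `κ(ρ) ≥ 1` for all `ρ ∈ (a,b)` with
`ρ ≥ ρ*`: the function `κ` cannot cross the line `κ = 1` from above. -/
theorem bfm_kappa_ge_one (a b : ℝ) (r W V N : ℝ → ℝ)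
    (h : IsBFMSolution (Set.Ioo a b) r W V N)
    (ρstar : ℝ) (hρstar : ρstar ∈ Set.Ioo a b)
    (hκ : 1 ≤ bfmKappa r W V N ρstar) :
    ∀ ρ ∈ Set.Ioo a b, ρstar ≤ ρ → 1 ≤ bfmKappa r W V N ρ := by
  intro ρ hρ hle
  have hderiv : ∀ x ∈ Set.Ioo a b, HasDerivAt (bfmKappa r W V N)
      (1 + 2 * V x ^ 2 / r x ^ 2 - bfmKappa r W V N x ^ 2) x :=
    fun x hx => h.hasDerivAt_bfmKappa hx
  refine sub_nonneg.mp (nonneg_of_neg_mul_le_deriv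
    (f := fun x => bfmKappa r W V N x - 1) (p := fun x => bfmKappa r W V N x + 1)
    (fun x hx => (hderiv x hx).sub_const 1)
    (fun x hx => ((hderiv x hx).continuousAt.add continuousAt_const).continuousWithinAt)
    (fun x _ => ?_) hρstar hρ hle (sub_nonneg.mpr hκ))
  have hpos : 0 ≤ 2 * V x ^ 2 / r x ^ 2 := by positivity
  nlinarith
end

section
/- Let r, W, V, N be a solution of the BFM system on an open interval I with 0 < N(ρ) ≤ 1 for all ρ ∈ I, let κ := (1/(2N))(1 + N² + 2V²/r² − (1−W²)²/r²), and set γ := κ + N. If γ(ρ*) ≤ 2 for some ρ* ∈ I, then γ(ρ) ≤ 2 for all ρ ∈ I with ρ ≥ ρ*. (The function γ cannot cross the line γ = 2 from below, since γ̇ = 1 − γ² + 3N(γ−N) and γ̇ = −3(1−N)² ≤ 0 whenever γ = 2.) -/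
/-- Along a solution of the BFM system, `γ = κ + N` satisfies `γ̇ = 1 − γ² + 3N(γ − N)`. -/
theorem IsBFMSolution.hasDerivAt_gamma {I : Set ℝ} {r W V N : ℝ → ℝ}
    (h : IsBFMSolution I r W V N) {ρ : ℝ} (hρ : ρ ∈ I) :
    HasDerivAt (fun x => bfmKappa r W V N x + N x)
      (1 - (bfmKappa r W V N ρ + N ρ) ^ 2 +
        3 * N ρ * (bfmKappa r W V N ρ + N ρ - N ρ)) ρ :=
  ((h.hasDerivAt_bfmKappa hρ).add (h.2.2.2.2.2 ρ hρ)).congr_deriv (by ring)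

/-- For a solution of the BFM system on an open interval `(a,b)`
with `0 < N ≤ 1`, if `γ(ρ*) ≤ 2` at some `ρ* ∈ (a,b)` (where `γ = κ + N`), then
`γ(ρ) ≤ 2` for all `ρ ∈ (a,b)` with `ρ ≥ ρ*`: the function `γ` cannot cross the
line `γ = 2` from below. -/
theorem bfm_gamma_le_two (a b : ℝ) (r W V N : ℝ → ℝ)
    (h : IsBFMSolution (Set.Ioo a b) r W V N)
    (hN : ∀ ρ ∈ Set.Ioo a b, 0 < N ρ ∧ N ρ ≤ 1)
    (ρstar : ℝ) (hρstar : ρstar ∈ Set.Ioo a b)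
    (hγ : bfmKappa r W V N ρstar + N ρstar ≤ 2) :
    ∀ ρ ∈ Set.Ioo a b, ρstar ≤ ρ → bfmKappa r W V N ρ + N ρ ≤ 2 := by
  intro ρ hρ hle
  have hmem : ∀ x ∈ Set.Icc ρstar ρ, x ∈ Set.Ioo a b := fun x hx =>
    ⟨hρstar.1.trans_le hx.1, hx.2.trans_lt hρ.2⟩
  have key : ∀ ε > 0, bfmKappa r W V N ρ + N ρ ≤ 2 + ε * (1 + (ρ - ρstar)) := by
    intro ε hε
    refine image_le_of_deriv_right_lt_deriv_boundary
      (f := fun x => bfmKappa r W V N x + N x)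
      (B := fun x => 2 + ε * (1 + (x - ρstar))) (B' := fun _ => ε)
      (fun x hx => (h.hasDerivAt_gamma (hmem x hx)).continuousAt.continuousWithinAt)
      (fun x hx => (h.hasDerivAt_gamma (hmem x ⟨hx.1, hx.2.le⟩)).hasDerivWithinAt)
      ?_ (fun x => ?_) ?_ (Set.right_mem_Icc.2 hle)
    · simp only [sub_self]
      linarith
    · simpa using ((((hasDerivAt_id x).sub_const ρstar).const_add 1).const_mul ε).const_add 2
    · intro x hx heq
      have hN1 := (hN x (hmem x ⟨hx.1, hx.2.le⟩)).2
      have hpos : 0 < ε * (1 + (x - ρstar)) := mul_pos hε (by linarith [hx.1])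
      beta_reduce at heq
      rw [heq]
      generalize ε * (1 + (x - ρstar)) = δ at hpos
      nlinarith [mul_nonneg hpos.le (sub_nonneg.2 hN1), sq_nonneg (1 - N x), sq_nonneg δ]
  have hlen : 0 < 1 + (ρ - ρstar) := by linarith
  refine le_of_forall_pos_le_add fun δ hδ => ?_
  simpa [div_mul_cancel₀ _ hlen.ne'] using key (δ / (1 + (ρ - ρstar))) (div_pos hδ hlen)
end

section
/- (Lemma 1 of the paper.) Let r, W, V, N be a solution of the BFM system on an interval I = (−∞, ρ₁) with 0 < N(ρ) ≤ 1 for all ρ ∈ I, and let κ := (1/(2N))(1 + N² + 2V²/r² − (1−W²)²/r²). Assume the solution is regular at the origin in the sense that there exists ρ* ∈ I such that κ(ρ) ≥ 1 and κ(ρ) + N(ρ) ≤ 2 for all ρ ≤ ρ*. Then 1 ≤ κ(ρ) ≤ 2 − N(ρ) for all ρ ∈ I. -/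
/-- A function satisfying the linear differential inequality `f' ≥ c f` on `(-∞, b)`, with `c`
continuous, stays nonnegative once it is nonnegative. -/
theorem nonneg_of_hasDerivAt_of_mul_le {f f' c : ℝ → ℝ} {b x y : ℝ}
    (hc : ContinuousOn c (Set.Iio b)) (hf : ∀ t ∈ Set.Iio b, HasDerivAt f (f' t) t)
    (hle : ∀ t ∈ Set.Iio b, c t * f t ≤ f' t) (hxy : x ≤ y) (hy : y < b) (hx : 0 ≤ f x) :
    0 ≤ f y := by
  have hint : ∀ t ∈ Set.Iio b, HasDerivAt (fun u => ∫ s in x..u, c s) (c t) t := by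
    intro t ht
    refine intervalIntegral.integral_hasDerivAt_right ?_
      (hc.stronglyMeasurableAtFilter isOpen_Iio t ht) (hc.continuousAt (isOpen_Iio.mem_nhds ht))
    refine (hc.mono fun s hs => ?_).intervalIntegrable
    exact hs.2.trans_lt (max_lt (hxy.trans_lt hy) ht)
  have hg : ∀ t ∈ Set.Iio b, HasDerivAt (fun u => f u * Real.exp (-∫ s in x..u, c s))
      ((f' t - c t * f t) * Real.exp (-∫ s in x..t, c s)) t := by
    intro t ht
    exact ((hf t ht).fun_mul (hint t ht).fun_neg.exp).congr_deriv (by ring)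
  have hsub : Set.Icc x y ⊆ Set.Iio b := fun t ht => ht.2.trans_lt hy
  have hmono : MonotoneOn (fun u => f u * Real.exp (-∫ s in x..u, c s)) (Set.Icc x y) := by
    refine monotoneOn_of_hasDerivWithinAt_nonneg (convex_Icc x y)
      (fun t ht => (hg t (hsub ht)).continuousAt.continuousWithinAt)
      (fun t ht => (hg t (hsub (interior_subset ht))).hasDerivWithinAt) fun t ht => ?_
    exact mul_nonneg (sub_nonneg.2 (hle t (hsub (interior_subset ht)))) (Real.exp_pos _).le
  have hxy' := hmono (Set.left_mem_Icc.2 hxy) (Set.right_mem_Icc.2 hxy) hxy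
  exact nonneg_of_mul_nonneg_left
    ((mul_nonneg hx (Real.exp_pos _).le).trans hxy') (Real.exp_pos _)

/-- Lemma 1 of the paper. For a solution of the BFM system on
`I = (−∞, ρ₁)` with `0 < N ≤ 1`, which is regular at the origin in the sense that
`κ ≥ 1` and `κ + N ≤ 2` hold for all `ρ ≤ ρ*` for some `ρ* ∈ I`, one has
`1 ≤ κ(ρ) ≤ 2 − N(ρ)` for all `ρ ∈ I`. -/
theorem bfm_lemma_one (ρ₁ : ℝ) (r W V N : ℝ → ℝ)
    (h : IsBFMSolution (Set.Iio ρ₁) r W V N)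
    (hN : ∀ ρ ∈ Set.Iio ρ₁, 0 < N ρ ∧ N ρ ≤ 1)
    (hreg : ∃ ρstar ∈ Set.Iio ρ₁, ∀ ρ ≤ ρstar,
      1 ≤ bfmKappa r W V N ρ ∧ bfmKappa r W V N ρ + N ρ ≤ 2) :
    ∀ ρ ∈ Set.Iio ρ₁, 1 ≤ bfmKappa r W V N ρ ∧ bfmKappa r W V N ρ ≤ 2 - N ρ := by
  intro ρ hρ
  obtain ⟨a, -, hreg⟩ := hreg
  rcases le_total ρ a with hρa | haρ
  · exact ⟨(hreg ρ hρa).1, by linarith [(hreg ρ hρa).2]⟩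
  have dκ : ∀ t ∈ Set.Iio ρ₁, HasDerivAt (bfmKappa r W V N) _ t :=
    fun t ht => h.hasDerivAt_bfmKappa ht
  have dN := h.2.2.2.2.2
  have cκ : ContinuousOn (bfmKappa r W V N) (Set.Iio ρ₁) :=
    fun t ht => (dκ t ht).continuousAt.continuousWithinAt
  have cN : ContinuousOn N (Set.Iio ρ₁) :=
    fun t ht => (dN t ht).continuousAt.continuousWithinAt
  constructor
  · refine sub_nonneg.1 (nonneg_of_hasDerivAt_of_mul_le
      (f := fun t => bfmKappa r W V N t - 1) (c := fun t => -(bfmKappa r W V N t + 1))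
      (by fun_prop) (fun t ht => (dκ t ht).sub_const 1) (fun t _ => ?_) haρ hρ
      (sub_nonneg.2 (hreg a le_rfl).1))
    have hU : 0 ≤ 2 * V t ^ 2 / r t ^ 2 := by positivity
    linarith
  · have hy := nonneg_of_hasDerivAt_of_mul_le
      (f := fun t => 2 - (bfmKappa r W V N t + N t))
      (c := fun t => 2 - (bfmKappa r W V N t + N t) - 4 + 3 * N t)
      (by fun_prop) (fun t ht => ((dκ t ht).fun_add (dN t ht)).const_sub 2) (fun t _ => ?_) haρ hρ
      (sub_nonneg.2 (hreg a le_rfl).2)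
    · linarith
    · nlinarith [sq_nonneg (1 - N t)]
end

section
/- Let r, W, V, N be a solution of the BFM system on an open interval (ρ*, ρ₀) with N > 0 there, and suppose r, W, V, N extend continuously to ρ₀ with N(ρ₀) = 0 and r(ρ₀) > 0. If the function κ := (1/(2N))(1 + N² + 2V²/r² − (1−W²)²/r²) is bounded on (ρ*, ρ₀), then the boundary values W₀ := W(ρ₀), V₀ := V(ρ₀), r₀ := r(ρ₀) satisfy the constraint r₀² = (1 − W₀²)² − 2V₀². -/
open Filter Topology


/-- Let `r, W, V, N` solve the BFM system on `(ρ*, ρ₀)` with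
`N > 0` there, and suppose they extend continuously to `ρ₀` with `N(ρ₀) = 0` and
`r(ρ₀) > 0`. If `κ` is bounded on `(ρ*, ρ₀)`, then the boundary values satisfy
`r₀² = (1 − W₀²)² − 2V₀²`. -/
theorem bfm_bubble_constraint (ρstar ρ₀ : ℝ) (hlt : ρstar < ρ₀) (r W V N : ℝ → ℝ)
    (h : IsBFMSolution (Set.Ioo ρstar ρ₀) r W V N)
    (hNpos : ∀ ρ ∈ Set.Ioo ρstar ρ₀, 0 < N ρ)
    (hrc : ContinuousWithinAt r (Set.Ioo ρstar ρ₀) ρ₀)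
    (hWc : ContinuousWithinAt W (Set.Ioo ρstar ρ₀) ρ₀)
    (hVc : ContinuousWithinAt V (Set.Ioo ρstar ρ₀) ρ₀)
    (hNc : ContinuousWithinAt N (Set.Ioo ρstar ρ₀) ρ₀)
    (hN0 : N ρ₀ = 0) (hr0 : 0 < r ρ₀)
    (hκbdd : ∃ C, ∀ ρ ∈ Set.Ioo ρstar ρ₀, |bfmKappa r W V N ρ| ≤ C) :
    r ρ₀ ^ 2 = (1 - W ρ₀ ^ 2) ^ 2 - 2 * V ρ₀ ^ 2 := by
  obtain ⟨C, hC⟩ := hκbdd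
  have : (𝓝[Set.Ioo ρstar ρ₀] ρ₀).NeBot := by
    rw [← mem_closure_iff_nhdsWithin_neBot, closure_Ioo hlt.ne]
    exact Set.right_mem_Icc.2 hlt.le
  have h_bracket : Tendsto
      (fun ρ => 1 + N ρ ^ 2 + 2 * V ρ ^ 2 / r ρ ^ 2 - (1 - W ρ ^ 2) ^ 2 / r ρ ^ 2)
      (𝓝[Set.Ioo ρstar ρ₀] ρ₀)
      (𝓝 (1 + N ρ₀ ^ 2 + 2 * V ρ₀ ^ 2 / r ρ₀ ^ 2 - (1 - W ρ₀ ^ 2) ^ 2 / r ρ₀ ^ 2)) := by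
    have hr : r ρ₀ ^ 2 ≠ 0 := by positivity
    exact (((hNc.pow 2).const_add 1).add (((hVc.pow 2).const_mul 2).div (hrc.pow 2) hr)).sub
      ((((hWc.pow 2).const_sub 1).pow 2).div (hrc.pow 2) hr)
  have h_zero : Tendsto
      (fun ρ => 1 + N ρ ^ 2 + 2 * V ρ ^ 2 / r ρ ^ 2 - (1 - W ρ ^ 2) ^ 2 / r ρ ^ 2)
      (𝓝[Set.Ioo ρstar ρ₀] ρ₀) (𝓝 0) := by
    have h_bound : Tendsto (fun ρ => 2 * N ρ * C) (𝓝[Set.Ioo ρstar ρ₀] ρ₀) (𝓝 0) := by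
      simpa [hN0] using (Tendsto.const_mul 2 hNc).mul_const C
    refine squeeze_zero_norm' ?_ h_bound
    filter_upwards [self_mem_nhdsWithin] with ρ hρ
    have hN := hNpos ρ hρ
    have h_eq : 1 + N ρ ^ 2 + 2 * V ρ ^ 2 / r ρ ^ 2 - (1 - W ρ ^ 2) ^ 2 / r ρ ^ 2
        = 2 * N ρ * bfmKappa r W V N ρ := by
      rw [bfmKappa, ← mul_assoc, mul_one_div_cancel (by positivity), one_mul]
    rw [h_eq, Real.norm_eq_abs, abs_mul, abs_of_pos (by positivity : 0 < 2 * N ρ)]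
    exact mul_le_mul_of_nonneg_left (hC ρ hρ) (by positivity)
  have h_limit := tendsto_nhds_unique h_bracket h_zero
  rw [hN0] at h_limit
  field_simp at h_limit
  linarith
end

section
/- Let r, W, V, N be a solution of the BFM system on an open interval (ρ*, ρ₀) with N > 0 there, and suppose r, W, V, N extend continuously to ρ₀ with N(ρ₀) = 0, r(ρ₀) > 0, V(ρ₀) ≠ 0, and N is differentiable at ρ₀. If the function κ := (1/(2N))(1 + N² + 2V²/r² − (1−W²)²/r²) is bounded on (ρ*, ρ₀), then N'(ρ₀) = −2V(ρ₀)²/r(ρ₀)² < 0; in particular the apparent horizon of a BFM bubble is not a regular (nondegenerate) black-hole horizon. -/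
/-- Let `r, W, V, N` solve the BFM system on `(ρ*, ρ₀)` with
`N > 0` there, extending continuously to `ρ₀` with `N(ρ₀) = 0`, `r(ρ₀) > 0`,
`V(ρ₀) ≠ 0`, and suppose `N` has (one-sided) derivative `D` at `ρ₀`. If `κ` is
bounded on `(ρ*, ρ₀)`, then `D = −2V(ρ₀)²/r(ρ₀)² < 0`; in particular the apparent
horizon of a BFM bubble is not a regular (nondegenerate) black-hole horizon. -/
theorem bfm_bubble_horizon_not_regular (ρstar ρ₀ : ℝ) (hlt : ρstar < ρ₀)
    (r W V N : ℝ → ℝ)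
    (h : IsBFMSolution (Set.Ioo ρstar ρ₀) r W V N)
    (hNpos : ∀ ρ ∈ Set.Ioo ρstar ρ₀, 0 < N ρ)
    (hrc : ContinuousWithinAt r (Set.Ioo ρstar ρ₀) ρ₀)
    (hWc : ContinuousWithinAt W (Set.Ioo ρstar ρ₀) ρ₀)
    (hVc : ContinuousWithinAt V (Set.Ioo ρstar ρ₀) ρ₀)
    (hNc : ContinuousWithinAt N (Set.Ioo ρstar ρ₀) ρ₀)
    (hN0 : N ρ₀ = 0) (hr0 : 0 < r ρ₀) (hV0 : V ρ₀ ≠ 0)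
    (D : ℝ) (hD : HasDerivWithinAt N D (Set.Ioo ρstar ρ₀) ρ₀)
    (hκbdd : ∃ C, ∀ ρ ∈ Set.Ioo ρstar ρ₀, |bfmKappa r W V N ρ| ≤ C) :
    D = -(2 * V ρ₀ ^ 2 / r ρ₀ ^ 2) ∧ D < 0 := by
  obtain ⟨-, -, -, -, -, hN⟩ := h
  obtain ⟨C, hC⟩ := hκbdd
  have hmem : Set.Ioo ρstar ρ₀ ∈ nhdsWithin ρ₀ (Set.Iio ρ₀) := Ioo_mem_nhdsLT hlt
  have hle : nhdsWithin ρ₀ (Set.Iio ρ₀) ≤ nhdsWithin ρ₀ (Set.Ioo ρstar ρ₀) :=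
    nhdsWithin_le_of_mem hmem
  have hNt : Filter.Tendsto N (nhdsWithin ρ₀ (Set.Iio ρ₀)) (nhds 0) := by
    have := hNc.tendsto.mono_left hle
    rwa [hN0] at this
  have hκN : Filter.Tendsto (fun ρ => bfmKappa r W V N ρ * N ρ)
      (nhdsWithin ρ₀ (Set.Iio ρ₀)) (nhds 0) := by
    refine squeeze_zero_norm' (a := fun ρ => C * |N ρ|) ?_ ?_
    · filter_upwards [hmem] with ρ hρ
      rw [norm_mul, Real.norm_eq_abs, Real.norm_eq_abs]
      exact mul_le_mul_of_nonneg_right (hC ρ hρ) (abs_nonneg _)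
    · simpa using hNt.abs.const_mul C
  have hVr : Filter.Tendsto (fun ρ => 2 * V ρ ^ 2 / r ρ ^ 2)
      (nhdsWithin ρ₀ (Set.Iio ρ₀)) (nhds (2 * V ρ₀ ^ 2 / r ρ₀ ^ 2)) :=
    (((hVc.tendsto.mono_left hle).pow 2).const_mul 2).div
      ((hrc.tendsto.mono_left hle).pow 2) (pow_ne_zero 2 hr0.ne')
  have hderiv : Filter.Tendsto (deriv N) (nhdsWithin ρ₀ (Set.Iio ρ₀))
      (nhds (-(2 * V ρ₀ ^ 2 / r ρ₀ ^ 2))) := by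
    have hlim := (hκN.sub (hNt.mul hNt)).sub hVr
    rw [mul_zero, sub_zero, zero_sub] at hlim
    refine hlim.congr' ?_
    filter_upwards [hmem] with ρ hρ
    rw [(hN ρ hρ).deriv]
    ring
  have hleft : HasDerivWithinAt N (-(2 * V ρ₀ ^ 2 / r ρ₀ ^ 2)) (Set.Iic ρ₀) ρ₀ :=
    hasDerivWithinAt_Iic_of_tendsto_deriv
      (fun ρ hρ => (hN ρ hρ).differentiableAt.differentiableWithinAt) hNc hmem hderiv
  have huniq : UniqueDiffWithinAt ℝ (Set.Ioo ρstar ρ₀) ρ₀ := by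
    refine uniqueDiffWithinAt_convex (convex_Ioo _ _) ?_ ?_
    · rw [interior_Ioo]
      exact Set.nonempty_Ioo.2 hlt
    · rw [closure_Ioo hlt.ne]
      exact Set.right_mem_Icc.2 hlt.le
  have hD_eq : D = -(2 * V ρ₀ ^ 2 / r ρ₀ ^ 2) :=
    huniq.eq_deriv _ hD (hleft.mono fun ρ hρ => hρ.2.le)
  refine ⟨hD_eq, ?_⟩
  rw [hD_eq, neg_lt_zero]
  positivity
end
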